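/- Let p, q ∈ ℝ[X] with deg p = n ≥ 2, deg q = m, m < n, and leading coefficient p_n ≠ 0, and let H = p(X) − T·q(X) ∈ (ℝ[T])[X], which has degree n in X with leading coefficient the constant p_n. Then the resultant Res_{n, n−1}(H, ∂H/∂X) ∈ ℝ[T] has degree at most 2n − 2 in T (so the discriminant of H, which equals (−1)^{n(n−1)/2} p_n^{−1} Res_{n,n−1}(H, ∂H/∂X), is a polynomial in T of degree at most 2n − 2). -/

import Mathlib

open Polynomial

/-- The `(d+e) × (d+e)` Sylvester matrix of `F` (regarded as a polynomial of degree at most `d`)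
and `G` (regarded as a polynomial of degree at most `e`): the first `e` rows are the shifted
coefficient vectors of `F` and the last `d` rows are the shifted coefficient vectors of `G`. -/
noncomputable def sylvesterMatrix {R : Type*} [CommRing R] (d e : ℕ) (F G : Polynomial R) :
    Matrix (Fin (e + d)) (Fin (e + d)) R :=
  Matrix.of fun i j =>
    if (i : ℕ) < e then
      if (i : ℕ) ≤ (j : ℕ) ∧ (j : ℕ) ≤ d + (i : ℕ) then F.coeff (d + (i : ℕ) - (j : ℕ)) else 0
    else
      if (i : ℕ) - e ≤ (j : ℕ) ∧ (j : ℕ) ≤ e + ((i : ℕ) - e) then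
        G.coeff (e + ((i : ℕ) - e) - (j : ℕ)) else 0

/-- The resultant `Res_{d,e}(F, G)`, the determinant of the Sylvester matrix. -/
noncomputable def resultantAux {R : Type*} [CommRing R] (d e : ℕ) (F G : Polynomial R) : R :=
  (sylvesterMatrix d e F G).det

/-- The δ-perturbed polynomial `H = p(X) - T·q(X)`, as an element of `(ℝ[T])[X]`:
its coefficients are the polynomials `pᵢ - qᵢ T` in the indeterminate `T`. -/
noncomputable def perturbedBy (p q : Polynomial ℝ) : Polynomial (Polynomial ℝ) :=
  p.map (C : ℝ →+* Polynomial ℝ) - C (X : Polynomial ℝ) * q.map (C : ℝ →+* Polynomial ℝ)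

lemma perturbedBy_coeff (p q : Polynomial ℝ) (k : ℕ) :
    (perturbedBy p q).coeff k = C (p.coeff k) - X * C (q.coeff k) := by
  simp [perturbedBy]

lemma perturbedBy_coeff_natDegree_le (p q : Polynomial ℝ) (k : ℕ) :
    ((perturbedBy p q).coeff k).natDegree ≤ 1 := by
  rw [perturbedBy_coeff]
  refine (natDegree_sub_le _ _).trans (max_le (by simp) ?_)
  exact (natDegree_mul_le).trans (by simp)

lemma derivative_perturbedBy_coeff_natDegree_le (p q : Polynomial ℝ) (k : ℕ) :
    ((derivative (perturbedBy p q)).coeff k).natDegree ≤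
      ((perturbedBy p q).coeff (k + 1)).natDegree := by
  rw [coeff_derivative]
  refine (natDegree_mul_le).trans ?_
  have : ((k : Polynomial ℝ) + 1).natDegree = 0 := by
    have h : ((k : Polynomial ℝ) + 1) = ((k + 1 : ℕ) : Polynomial ℝ) := by push_cast; rfl
    rw [h, natDegree_natCast]
  omega

lemma natDegree_det_lt {N : ℕ} (M : Matrix (Fin N) (Fin N) (Polynomial ℝ)) (j₀ : Fin N)
    (h1 : ∀ i j, (M i j).natDegree ≤ 1) (h0 : ∀ i, (M i j₀).natDegree = 0) :
    M.det.natDegree ≤ N - 1 := by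
  rw [Matrix.det_apply]
  refine natDegree_sum_le_of_forall_le _ _ fun σ _ => ?_
  refine (natDegree_smul_le _ _).trans ?_
  refine (natDegree_prod_le _ _).trans ?_
  have : ∑ i, (M (σ i) i).natDegree < ∑ _i : Fin N, 1 :=
    Finset.sum_lt_sum (fun i _ => h1 _ _) ⟨j₀, Finset.mem_univ _, by rw [h0]; exact one_pos⟩
  simp only [Finset.sum_const, Finset.card_univ, Fintype.card_fin, smul_eq_mul, mul_one] at this
  omega

/-- **Hidden polynomial, case `m < n`.** If `deg p = n ≥ 2`, `deg q = m < n` and `p_n ≠ 0`,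
then `H = p - T·q` has degree `n` in `X` with (constant) leading coefficient `p_n`, and the
resultant `Res_{n,n-1}(H, ∂H/∂X)` has degree at most `2n - 2` in `T` (so the discriminant of
`H`, which equals `(-1)^(n(n-1)/2) p_n⁻¹ Res_{n,n-1}(H, ∂H/∂X)`, is a polynomial in `T` of
degree at most `2n - 2`). -/
theorem hidden_polynomial_degree_case_m_lt_n
    (p q : Polynomial ℝ) (n m : ℕ) (hn : 2 ≤ n) (hpn : p.natDegree = n)
    (hqm : q.natDegree = m) (hmn : m < n) (hlead : p.coeff n ≠ 0) :
    (perturbedBy p q).natDegree = n ∧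
    (perturbedBy p q).coeff n = C (p.coeff n) ∧
    (resultantAux n (n - 1) (perturbedBy p q)
        (derivative (perturbedBy p q))).natDegree ≤ 2 * n - 2 ∧
    ((-1 : Polynomial ℝ) ^ (n * (n - 1) / 2) * C (p.coeff n)⁻¹ *
        resultantAux n (n - 1) (perturbedBy p q)
          (derivative (perturbedBy p q))).natDegree ≤ 2 * n - 2 := by
  have hcn : (perturbedBy p q).coeff n = C (p.coeff n) := by
    rw [perturbedBy_coeff, coeff_eq_zero_of_natDegree_lt (p := q) (by omega)]
    simp
  have hres : (resultantAux n (n - 1) (perturbedBy p q)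
        (derivative (perturbedBy p q))).natDegree ≤ 2 * n - 2 := by
    have hdet := natDegree_det_lt
      (sylvesterMatrix n (n - 1) (perturbedBy p q) (derivative (perturbedBy p q)))
      ⟨0, by omega⟩ ?_ ?_
    · unfold resultantAux
      omega
    · intro i j
      simp only [sylvesterMatrix, Matrix.of_apply]
      split_ifs
      · exact perturbedBy_coeff_natDegree_le _ _ _
      · simp
      · exact (derivative_perturbedBy_coeff_natDegree_le _ _ _).trans
          (perturbedBy_coeff_natDegree_le _ _ _)
      · simp
    · intro i
      simp only [sylvesterMatrix, Matrix.of_apply]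
      split_ifs with h1 h2 h2
      · rw [show n + (i : ℕ) - 0 = n by omega, hcn, natDegree_C]
      · simp
      · have h := derivative_perturbedBy_coeff_natDegree_le p q (n - 1 + ((i : ℕ) - (n - 1)) - 0)
        rw [show n - 1 + ((i : ℕ) - (n - 1)) - 0 + 1 = n by omega, hcn, natDegree_C] at h
        omega
      · simp
  refine ⟨?_, hcn, hres, ?_⟩
  · refine natDegree_eq_of_le_of_coeff_ne_zero ?_ ?_
    · rw [natDegree_le_iff_coeff_eq_zero]
      intro k hk
      rw [perturbedBy_coeff, coeff_eq_zero_of_natDegree_lt (p := q) (by omega),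
        coeff_eq_zero_of_natDegree_lt (p := p) (by omega)]
      simp
    · rw [hcn]
      simpa using hlead
  · have h : (-1 : Polynomial ℝ) ^ (n * (n - 1) / 2) * C (p.coeff n)⁻¹ =
        C ((-1) ^ (n * (n - 1) / 2) * (p.coeff n)⁻¹) := by simp
    rw [h]
    exact (natDegree_C_mul_le _ _).trans hres
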